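/- arXiv:2110.09954 — 8 statements merged into one kernel-verified Lean document; each statement's English description precedes it below -/
import Mathlib

section
/- Suppose Θ is a standard Borel space with 𝒜 its Borel σ-field, 𝒳 is countably generated, and P is a Markov kernel from (Θ,𝒜) to (X,𝒳). A bounded 𝒜-measurable function a : Θ → ℝ is measurable with respect to the minimal sufficient σ-field 𝒜* if and only if a is constant on observational-equivalence classes, i.e., for all θ₁, θ₂ ∈ Θ, P^{θ₁} = P^{θ₂} (as measures on (X,𝒳)) implies a(θ₁) = a(θ₂). -/
open MeasureTheory ProbabilityTheory
open scoped ENNReal NNReal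

/-- The minimal sufficient σ-field: the sub-σ-field of the parameter space generated by
the functions `θ ↦ P θ E` for measurable `E`. -/
noncomputable def minimalSufficient {Θ X : Type*} [mΘ : MeasurableSpace Θ]
    [mX : MeasurableSpace X] (P : Kernel Θ X) : MeasurableSpace Θ :=
  ⨆ E ∈ {E : Set X | MeasurableSet E},
    MeasurableSpace.comap (fun θ => P θ E) (inferInstance : MeasurableSpace ℝ≥0∞)

/-- If `Θ` is standard Borel and `𝒳` is countably generated, a bounded measurable real
function `a` on `Θ` is measurable w.r.t. the minimal sufficient σ-field iff it is constant
on observational-equivalence classes (`P θ₁ = P θ₂ → a θ₁ = a θ₂`). -/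
theorem measurable_minimalSufficient_iff_const_on_equiv_classes
    {Θ X : Type*} [mΘ : MeasurableSpace Θ] [StandardBorelSpace Θ]
    [mX : MeasurableSpace X] [MeasurableSpace.CountablyGenerated X]
    (P : Kernel Θ X) [IsMarkovKernel P]
    (a : Θ → ℝ) (ha : Measurable a) (hbd : ∃ C : ℝ, ∀ θ, |a θ| ≤ C) :
    Measurable[minimalSufficient P] a ↔
      ∀ θ₁ θ₂ : Θ, P θ₁ = P θ₂ → a θ₁ = a θ₂ := by
  constructor
  · intro h θ₁ θ₂ hP
    have hle : minimalSufficient P ≤ MeasurableSpace.comap (fun θ => P θ) inferInstance := by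
      refine iSup₂_le fun E hE => ?_
      rintro _ ⟨t, ht, rfl⟩
      exact ⟨(fun μ : Measure X => μ E) ⁻¹' t, Measure.measurable_coe hE ht, rfl⟩
    obtain ⟨t, -, ht⟩ := hle _ (h (measurableSet_singleton (a θ₁)))
    have h1 : θ₁ ∈ (fun θ => P θ) ⁻¹' t := by rw [ht]; rfl
    have h2 : θ₂ ∈ (fun θ => P θ) ⁻¹' t := by
      change P θ₂ ∈ t
      rw [← hP]
      exact h1
    rw [ht] at h2
    exact (Set.mem_singleton_iff.1 h2).symm
  · intro h
    set C : Set (Set X) := generateSetAlgebra (MeasurableSpace.countableGeneratingSet X) with hC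
    have hCc : C.Countable :=
      countable_generateSetAlgebra MeasurableSpace.countable_countableGeneratingSet
    have hgen : mX = MeasurableSpace.generateFrom C := by
      rw [hC, generateFrom_generateSetAlgebra_eq,
        MeasurableSpace.generateFrom_countableGeneratingSet]
    have hmeas : ∀ E ∈ C, MeasurableSet E := by
      intro E hE
      rw [hgen]
      exact MeasurableSpace.measurableSet_generateFrom hE
    have hpi : IsPiSystem C := fun s hs t ht _ =>
      isSetAlgebra_generateSetAlgebra.inter_mem hs ht
    have : Countable C := hCc.to_subtype
    let F : Θ → (C → ℝ≥0∞) := fun θ E => P θ E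
    have hF : Measurable F :=
      measurable_pi_lambda _ fun E => P.measurable_coe (hmeas E E.2)
    have hF' : Measurable[minimalSufficient P] F := by
      refine @measurable_pi_lambda _ _ _ (minimalSufficient P) _ _ fun E => ?_
      refine Measurable.mono (comap_measurable (fun θ => P θ (E : Set X))) ?_ le_rfl
      exact le_iSup₂_of_le (E : Set X) (hmeas E E.2) le_rfl
    have hinj : ∀ θ₁ θ₂, F θ₁ = F θ₂ → a θ₁ = a θ₂ := fun θ₁ θ₂ hh =>
      h _ _ (ext_of_generate_finite C hgen hpi (fun s hs => congrFun hh ⟨s, hs⟩) (by simp))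
    intro B hB
    have hpre : F ⁻¹' (F '' (a ⁻¹' B)) = a ⁻¹' B := by
      refine Set.Subset.antisymm ?_ (Set.subset_preimage_image _ _)
      rintro θ ⟨θ', hθ', he⟩
      change a θ ∈ B
      rw [← hinj _ _ he]
      exact hθ'
    have hm : MeasurableSet (F ⁻¹' (F '' (a ⁻¹' B))) := by rw [hpre]; exact ha hB
    obtain ⟨u, hu, hue⟩ := hF.measurableSet_preimage_iff_preimage_val.1 hm
    have : a ⁻¹' B = F ⁻¹' u := by
      rw [← hpre]
      ext θ
      exact (Set.ext_iff.1 hue ⟨F θ, θ, rfl⟩).symm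
    rw [this]
    exact hF' hu
end

section
/- Suppose Θ is a standard Borel space with 𝒜 its Borel σ-field, 𝒳 is countably generated, and P is a Markov kernel from (Θ,𝒜) to (X,𝒳). Then the model is sampling identified if and only if it is measurably identified; that is, the map θ ↦ P^θ (from Θ to probability measures on (X,𝒳)) is injective if and only if the minimal sufficient σ-field 𝒜* equals 𝒜. -/
open MeasureTheory ProbabilityTheory
open scoped ENNReal NNReal

/-- For a standard Borel parameter space and a countably generated sample σ-field, the model
is sampling identified (`θ ↦ P θ` injective) iff it is measurably identified
(the minimal sufficient σ-field equals the whole parameter σ-field). -/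
theorem samplingIdentified_iff_measurablyIdentified
    {Θ X : Type*} [mΘ : MeasurableSpace Θ] [StandardBorelSpace Θ]
    [mX : MeasurableSpace X] [MeasurableSpace.CountablyGenerated X]
    (P : Kernel Θ X) [IsMarkovKernel P] :
    Function.Injective (fun θ : Θ => (P θ : Measure X)) ↔ minimalSufficient P = mΘ := by
  constructor
  · intro hinj
    apply le_antisymm
    · refine iSup₂_le fun E hE => ?_
      exact (P.measurable_coe hE).comap_le
    · let t := MeasurableSpace.natGeneratingSequence X
      have ht : ∀ n, MeasurableSet (t n) := MeasurableSpace.measurableSet_natGeneratingSequence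
      let A : Finset ℕ → Set X := fun F => ⋂ i ∈ F, t i
      have hA : ∀ F, MeasurableSet (A F) := fun F =>
        Finset.measurableSet_biInter F fun i _ => ht i
      have hgen : mX = MeasurableSpace.generateFrom (Set.range A) := by
        apply le_antisymm
        · rw [← MeasurableSpace.generateFrom_natGeneratingSequence X]
          apply MeasurableSpace.generateFrom_mono
          rintro _ ⟨n, rfl⟩
          exact ⟨{n}, by simp [A, t]⟩
        · apply MeasurableSpace.generateFrom_le
          rintro _ ⟨F, rfl⟩
          exact hA F
      have hpi : IsPiSystem (Set.range A) := by
        rintro _ ⟨F, rfl⟩ _ ⟨G, rfl⟩ _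
        refine ⟨F ∪ G, ?_⟩
        simp only [A]
        exact Finset.iInf_union (f := t) (s := F) (t := G)
      let f : Θ → (Finset ℕ → ℝ≥0∞) := fun θ F => P θ (A F)
      have hf : Measurable f := measurable_pi_lambda _ fun F => P.measurable_coe (hA F)
      have hfi : Function.Injective f := by
        intro θ θ' h
        apply hinj
        refine ext_of_generate_finite (Set.range A) hgen hpi ?_ (by simp)
        rintro _ ⟨F, rfl⟩
        exact congrFun h F
      refine (hf.measurableEmbedding hfi).comap_eq.symm.le.trans ?_
      simp only [MeasurableSpace.pi, MeasurableSpace.comap_iSup, MeasurableSpace.comap_comp]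
      refine iSup_le fun F => ?_
      exact le_iSup₂_of_le (f := fun (E : Set X) (_ : E ∈ {E : Set X | MeasurableSet E}) =>
        MeasurableSpace.comap (fun θ => P θ E) (inferInstance : MeasurableSpace ℝ≥0∞))
        (A F) (hA F) le_rfl
  · intro h θ θ' hθ
    have hle : minimalSufficient P ≤
        MeasurableSpace.comap (fun θ : Θ => (P θ : Measure X)) inferInstance := by
      refine iSup₂_le fun E hE => ?_
      rintro _ ⟨B, hB, rfl⟩
      exact ⟨(fun μ : Measure X => μ E) ⁻¹' B, Measure.measurable_coe hE hB, rfl⟩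
    rw [h] at hle
    obtain ⟨B, -, hB⟩ := hle _ (measurableSet_singleton θ')
    have h1 : θ' ∈ (fun θ : Θ => (P θ : Measure X)) ⁻¹' B := by rw [hB]; rfl
    have h2 : θ ∈ (fun θ : Θ => (P θ : Measure X)) ⁻¹' B := by
      rw [Set.mem_preimage] at h1 ⊢
      exact (show P θ = P θ' from hθ) ▸ h1
    rw [hB] at h2
    exact h2
end

section
/- Suppose Θ is a standard Borel space with 𝒜 its Borel σ-field, 𝒳 is countably generated, P is a Markov kernel from (Θ,𝒜) to (X,𝒳), and μ is a prior probability measure on (Θ,𝒜). Then the Bayesian model is Bayesian identified — i.e., for every A ∈ 𝒜 there exists B ∈ 𝒜* with μ(A △ B) = 0, where △ denotes symmetric difference — if and only if there exists Θ₀ ∈ 𝒜 with μ(Θ₀) = 0 such that the map θ ↦ P^θ is injective on Θ ∖ Θ₀. -/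
open MeasureTheory ProbabilityTheory
open scoped ENNReal NNReal symmDiff

/-- Bayesian identification: the model is Bayesian identified iff the sampling map `θ ↦ P θ`
is injective outside a prior-null set. -/
theorem bayesianIdentified_iff_injective_off_null_set
    {Θ X : Type*} [mΘ : MeasurableSpace Θ] [StandardBorelSpace Θ]
    [mX : MeasurableSpace X] [MeasurableSpace.CountablyGenerated X]
    (P : Kernel Θ X) [IsMarkovKernel P]
    (μ : Measure Θ) [IsProbabilityMeasure μ] :
    (∀ A : Set Θ, MeasurableSet A →
        ∃ B : Set Θ, MeasurableSet[minimalSufficient P] B ∧ μ (A ∆ B) = 0) ↔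
      ∃ Θ₀ : Set Θ, MeasurableSet Θ₀ ∧ μ Θ₀ = 0 ∧
        Set.InjOn (fun θ : Θ => (P θ : Measure X)) Θ₀ᶜ := by
  have hle : minimalSufficient P ≤ MeasurableSpace.comap (fun θ => P θ) inferInstance := by
    refine iSup₂_le fun E hE => ?_
    rintro _ ⟨s, hs, rfl⟩
    exact ⟨(fun ν : Measure X => ν E) ⁻¹' s, Measure.measurable_coe hE hs, rfl⟩
  have hle' : minimalSufficient P ≤ mΘ := hle.trans P.measurable.comap_le
  constructor
  · intro h
    have hA := MeasurableSpace.measurableSet_natGeneratingSequence (α := Θ)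
    choose B hB hμ using fun n => h _ (hA n)
    refine ⟨⋃ n, MeasurableSpace.natGeneratingSequence Θ n ∆ B n,
      MeasurableSet.iUnion fun n => (hA n).symmDiff (hle' _ (hB n)),
      measure_iUnion_null hμ, ?_⟩
    intro x hx y hy hxy
    apply MeasurableSpace.injective_mapNatBool Θ
    funext n
    obtain ⟨s, hs, hsB⟩ := hle _ (hB n)
    have h1 : x ∈ B n ↔ y ∈ B n := by
      rw [← hsB]
      simp only [Set.mem_preimage]
      rw [show P x = P y from hxy]
    simp only [Set.mem_compl_iff, Set.mem_iUnion, not_exists, Set.mem_symmDiff] at hx hy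
    have hx := hx n
    have hy := hy n
    simp only [MeasurableSpace.mapNatBool]
    rw [decide_eq_decide]
    tauto
  · rintro ⟨Θ₀, h0, hμ0, hinj⟩ A hA
    let C := generateSetAlgebra (MeasurableSpace.countableGeneratingSet X)
    have hCc : C.Countable := countable_generateSetAlgebra
      MeasurableSpace.countable_countableGeneratingSet
    have hgen : mX = MeasurableSpace.generateFrom C := by
      rw [generateFrom_generateSetAlgebra_eq, MeasurableSpace.generateFrom_countableGeneratingSet]
    have hCm : ∀ E ∈ C, MeasurableSet E := fun E hE => by
      rw [hgen]; exact MeasurableSpace.measurableSet_generateFrom hE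
    have hpi : IsPiSystem C := fun s hs t ht _ =>
      isSetAlgebra_generateSetAlgebra.inter_mem hs ht
    have : Countable C := hCc.to_subtype
    let f : Θ → (C → ℝ≥0∞) := fun θ E => P θ E
    have hfm : Measurable[minimalSufficient P] f := by
      refine @measurable_pi_lambda _ _ _ (minimalSufficient P) _ _ fun E => ?_
      have : MeasurableSpace.comap (fun θ => P θ (E : Set X)) inferInstance
          ≤ minimalSufficient P :=
        le_iSup₂_of_le (f := fun (E : Set X) (_ : E ∈ {E : Set X | MeasurableSet E}) =>
          MeasurableSpace.comap (fun θ => P θ E) (inferInstance : MeasurableSpace ℝ≥0∞))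
          (E : Set X) (hCm _ E.2) le_rfl
      exact fun s hs => this _ ⟨s, hs, rfl⟩
    have hfi : Set.InjOn f Θ₀ᶜ := by
      intro x hx y hy hxy
      refine hinj hx hy ?_
      exact ext_of_generate_finite C hgen hpi (fun s hs => congrFun hxy ⟨s, hs⟩) (by simp)
    have hD : MeasurableSet (f '' (A \ Θ₀)) :=
      (hA.diff h0).image_of_measurable_injOn (hfm.mono hle' le_rfl)
        (hfi.mono fun x hx => hx.2)
    refine ⟨f ⁻¹' (f '' (A \ Θ₀)), hfm hD, measure_mono_null ?_ hμ0⟩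
    rintro x (⟨hxA, hxB⟩ | ⟨⟨y, hy, hyx⟩, hxA⟩)
    · by_contra hx
      exact hxB ⟨x, ⟨hxA, hx⟩, rfl⟩
    · by_contra hx
      exact hxA (hfi hy.2 hx hyx ▸ hy.1)
end

section
/- Let (Θ,𝒜), (X,𝒳) be measurable spaces, P a Markov kernel from (Θ,𝒜) to (X,𝒳), μ a prior probability measure on (Θ,𝒜), and Π the joint probability on (Θ×X, 𝒜⊗𝒳) given by Π(A×E) = ∫_A P^θ(E) μ(dθ). Let ℬ ⊆ 𝒜 be a sub-σ-field and let ℬ𝒮 be the σ-field on Θ×X generated by the conditional expectations E_Π[t∘pr₂ | pr₁⁻¹ℬ] over all bounded 𝒳-measurable t : X → ℝ, where pr₁, pr₂ are the coordinate projections. If ℬ is exactly estimable — i.e., for every bounded ℬ-measurable a : Θ → ℝ there exists a bounded 𝒳-measurable t : X → ℝ with a(θ) = t(x) for Π-almost every (θ,x) — then ℬ is Bayesian identified: for every bounded ℬ-measurable a : Θ → ℝ, the function (θ,x) ↦ a(θ) is Π-almost everywhere equal to a ℬ𝒮-measurable function. -/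
open MeasureTheory ProbabilityTheory
open scoped ENNReal NNReal ProbabilityTheory

/-- The projection `ℬ𝒮` of the sample σ-field on the sub-σ-field `B` of the parameter space:
the σ-field on `Θ × X` generated by the conditional expectations (under the joint measure `Π`)
of bounded measurable functions of the sample given `pr₁⁻¹ ℬ`. -/
noncomputable def projSigmaField {Θ X : Type*} [mΘ : MeasurableSpace Θ]
    [mX : MeasurableSpace X] (Pr : Measure (Θ × X)) (B : MeasurableSpace Θ) :
    MeasurableSpace (Θ × X) :=
  ⨆ t ∈ {t : X → ℝ | Measurable t ∧ ∃ C : ℝ, ∀ x, |t x| ≤ C},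
    MeasurableSpace.comap (Pr[fun p : Θ × X => t p.2 | MeasurableSpace.comap Prod.fst B])
      (inferInstance : MeasurableSpace ℝ)

/-- If a sub-σ-field `B` of the parameter σ-field is exactly estimable (every bounded
`B`-measurable function of `θ` equals `Π`-a.s. a bounded measurable function of `x`), then `B`
is Bayesian identified: every bounded `B`-measurable function of `θ` is `Π`-a.e. equal to a
`ℬ𝒮`-measurable function on `Θ × X`. -/
theorem bayesianIdentified_of_exactlyEstimable
    {Θ X : Type*} [mΘ : MeasurableSpace Θ] [mX : MeasurableSpace X]
    (P : Kernel Θ X) [IsMarkovKernel P]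
    (μ : Measure Θ) [IsProbabilityMeasure μ]
    (B : MeasurableSpace Θ) (hB : B ≤ mΘ)
    (hest : ∀ a : Θ → ℝ, Measurable[B] a → (∃ C : ℝ, ∀ θ, |a θ| ≤ C) →
      ∃ t : X → ℝ, Measurable t ∧ (∃ C : ℝ, ∀ x, |t x| ≤ C) ∧
        (fun p : Θ × X => a p.1) =ᵐ[μ ⊗ₘ P] (fun p : Θ × X => t p.2)) :
    ∀ a : Θ → ℝ, Measurable[B] a → (∃ C : ℝ, ∀ θ, |a θ| ≤ C) →
      ∃ g : Θ × X → ℝ, Measurable[projSigmaField (mΘ := mΘ) (μ ⊗ₘ P) B] g ∧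
        (fun p : Θ × X => a p.1) =ᵐ[μ ⊗ₘ P] g := by
  intro a ha hC
  obtain ⟨t, ht, htC, hat⟩ := hest a ha hC
  obtain ⟨C, hC⟩ := hC
  refine ⟨(μ ⊗ₘ P)[fun p : Θ × X => t p.2 | MeasurableSpace.comap Prod.fst B], ?_, ?_⟩
  · refine Measurable.mono (comap_measurable _) ?_ le_rfl
    exact le_iSup₂_of_le (f := fun (t : X → ℝ)
      (_ : t ∈ {t : X → ℝ | Measurable t ∧ ∃ C : ℝ, ∀ x, |t x| ≤ C}) =>
        MeasurableSpace.comap ((μ ⊗ₘ P)[fun p : Θ × X => t p.2 | MeasurableSpace.comap Prod.fst B])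
          (inferInstance : MeasurableSpace ℝ)) t ⟨ht, htC⟩ le_rfl
  · have hm : MeasurableSpace.comap Prod.fst B ≤ @Prod.instMeasurableSpace Θ X mΘ mX :=
      (MeasurableSpace.comap_mono hB).trans le_sup_left
    have h1 : Measurable[MeasurableSpace.comap Prod.fst B] (fun p : Θ × X => a p.1) :=
      ha.comp (comap_measurable _)
    have hi : Integrable (fun p : Θ × X => a p.1) (μ ⊗ₘ P) := by
      refine Integrable.of_bound (h1.mono hm le_rfl).aestronglyMeasurable C ?_
      exact Filter.Eventually.of_forall fun p => hC p.1
    have h2 := condExp_of_stronglyMeasurable hm h1.stronglyMeasurable hi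
    have h3 := condExp_congr_ae (m := MeasurableSpace.comap Prod.fst B) hat
    rw [h2] at h3
    exact h3
end

section
/- Let (Θ,𝒜), (X,𝒳) be measurable spaces, P a Markov kernel from (Θ,𝒜) to (X,𝒳), μ a prior probability measure on (Θ,𝒜), and Π the joint probability on Θ×X given by Π(A×E) = ∫_A P^θ(E) μ(dθ). Let 𝒜* be the sub-σ-field of 𝒜 generated by the functions θ ↦ P^θ(E), E ∈ 𝒳. Assume the minimal sufficient σ-field 𝒜* is exactly estimable: for every bounded 𝒜*-measurable b : Θ → ℝ there exists a bounded 𝒳-measurable t : X → ℝ with b(θ) = t(x) Π-a.s. Then a bounded 𝒜-measurable function a : Θ → ℝ is exactly estimable (there exists a bounded 𝒳-measurable t with a(θ) = t(x) Π-a.s.) if and only if a is almost surely identified, i.e., a is μ-almost everywhere equal to a bounded 𝒜*-measurable function. -/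
open MeasureTheory ProbabilityTheory
open scoped ENNReal NNReal ProbabilityTheory

/-- If the minimal sufficient σ-field is exactly estimable in the Bayesian model `μ ⊗ₘ P`,
then a bounded measurable function of the parameter is exactly estimable iff it is a.s.
identified, i.e. `μ`-a.e. equal to a bounded function measurable w.r.t. the minimal
sufficient σ-field. -/
theorem exactlyEstimable_iff_as_identified
    {Θ X : Type*} [mΘ : MeasurableSpace Θ] [mX : MeasurableSpace X]
    (P : Kernel Θ X) [IsMarkovKernel P]
    (μ : Measure Θ) [IsProbabilityMeasure μ]
    (hAX : ∀ b : Θ → ℝ, Measurable[minimalSufficient P] b → (∃ C : ℝ, ∀ θ, |b θ| ≤ C) →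
      ∃ t : X → ℝ, Measurable t ∧ (∃ C : ℝ, ∀ x, |t x| ≤ C) ∧
        (fun p : Θ × X => b p.1) =ᵐ[μ ⊗ₘ P] (fun p : Θ × X => t p.2))
    (a : Θ → ℝ) (ha : Measurable a) (hbd : ∃ C : ℝ, ∀ θ, |a θ| ≤ C) :
    (∃ t : X → ℝ, Measurable t ∧ (∃ C : ℝ, ∀ x, |t x| ≤ C) ∧
        (fun p : Θ × X => a p.1) =ᵐ[μ ⊗ₘ P] (fun p : Θ × X => t p.2)) ↔
      (∃ b : Θ → ℝ, Measurable[minimalSufficient P] b ∧ (∃ C : ℝ, ∀ θ, |b θ| ≤ C) ∧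
        a =ᵐ[μ] b) := by
  constructor
  · rintro ⟨t, ht, ⟨C, hC⟩, h⟩
    refine ⟨fun θ => ∫ x, t x ∂(P θ), ?_, ⟨C, fun θ => ?_⟩, ?_⟩
    · have hP : Measurable[minimalSufficient P] (fun θ => P θ) := by
        refine @Measure.measurable_of_measurable_coe X Θ mX (minimalSufficient P) _ ?_
        intro E hE
        rw [measurable_iff_comap_le]
        exact le_iSup₂_of_le (f := fun E (_ : E ∈ {E : Set X | MeasurableSet E}) =>
          MeasurableSpace.comap (fun θ => P θ E) (inferInstance : MeasurableSpace ℝ≥0∞))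
          E hE le_rfl
      let P' : @Kernel Θ X (minimalSufficient P) mX :=
        @Kernel.mk Θ X (minimalSufficient P) mX (fun θ => P θ) hP
      exact (StronglyMeasurable.integral_kernel (mα := minimalSufficient P) (κ := P') (f := t)
        ht.stronglyMeasurable).measurable
    · have := norm_integral_le_of_norm_le_const (μ := P θ) (f := t) (C := C)
        (Filter.Eventually.of_forall fun x => by simpa using hC x)
      simpa using this
    · have h2 := Measure.ae_ae_of_ae_compProd h
      filter_upwards [h2] with θ hθ
      have : ∫ x, t x ∂(P θ) = ∫ _x, a θ ∂(P θ) :=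
        integral_congr_ae (by filter_upwards [hθ] with x hx using hx.symm)
      simp [this]
  · rintro ⟨b, hb, hbC, hab⟩
    obtain ⟨t, ht, htC, h⟩ := hAX b hb hbC
    refine ⟨t, ht, htC, ?_⟩
    have hq : Measure.QuasiMeasurePreserving (Prod.fst : Θ × X → Θ) (μ ⊗ₘ P) μ := by
      refine ⟨measurable_fst, ?_⟩
      have : (μ ⊗ₘ P).map Prod.fst = μ := Measure.fst_compProd μ P
      rw [this]
    exact (hq.ae_eq hab).trans h
end

section
/- Let (Θ,𝒜), (X,𝒳) be measurable spaces, P a Markov kernel from (Θ,𝒜) to (X,𝒳), μ a prior probability measure on (Θ,𝒜), and Π the joint probability on Θ×X given by Π(A×E) = ∫_A P^θ(E) μ(dθ). Let ℬ ⊆ 𝒜 be a sampling-sufficient sub-σ-field, i.e., θ ↦ P^θ(E) is ℬ-measurable for every E ∈ 𝒳. Then for every bounded 𝒳-measurable t : X → ℝ, the conditional expectations under Π satisfy E_Π[t∘pr₂ | pr₁⁻¹𝒜] = E_Π[t∘pr₂ | pr₁⁻¹ℬ] Π-almost surely (here pr₁, pr₂ are the coordinate projections of Θ×X); that is, conditionally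 on the sufficient parameter the data carry no additional information about θ. -/
open MeasureTheory ProbabilityTheory
open scoped ENNReal NNReal ProbabilityTheory


theorem aux_meas {Θ X : Type*} (B : MeasurableSpace Θ) [mΘ : MeasurableSpace Θ] [mX : MeasurableSpace X]
    (P : Kernel Θ X) [IsMarkovKernel P]
    (hsuff : ∀ E : Set X, MeasurableSet E → Measurable[B] (fun θ => P θ E))
    (t : X → ℝ) (ht : Measurable t) :
    StronglyMeasurable[B] (fun θ => ∫ x, t x ∂(P θ)) := by
  let Q : @Kernel Θ X B mX := @Kernel.mk Θ X B mX (fun θ => P θ)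
    (@Measure.measurable_of_measurable_coe X Θ mX B _ hsuff)
  have : @IsMarkovKernel Θ X B mX Q :=
    @IsMarkovKernel.mk Θ X B mX Q (fun θ => inferInstanceAs (IsProbabilityMeasure (P θ)))
  exact @StronglyMeasurable.integral_kernel Θ X B mX Q ℝ _ _ t ht.stronglyMeasurable

theorem aux_condexp {Θ X : Type*} (B : MeasurableSpace Θ) [mΘ : MeasurableSpace Θ]
    [mX : MeasurableSpace X]
    (P : Kernel Θ X) [IsMarkovKernel P]
    (μ : Measure Θ) [IsProbabilityMeasure μ] (hB : B ≤ mΘ)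
    (hsuff : ∀ E : Set X, MeasurableSet E → Measurable[B] (fun θ => P θ E))
    (t : X → ℝ) (ht : Measurable t) (hC : ∃ C : ℝ, ∀ x, |t x| ≤ C) :
    (fun p : Θ × X => ∫ x, t x ∂(P p.1)) =ᵐ[μ ⊗ₘ P]
      (μ ⊗ₘ P)[fun p : Θ × X => t p.2 | MeasurableSpace.comap Prod.fst B] := by
  obtain ⟨C, hC⟩ := hC
  have hg := aux_meas B P hsuff t ht
  have hle : MeasurableSpace.comap Prod.fst B ≤ (inferInstance : MeasurableSpace (Θ × X)) :=
    (MeasurableSpace.comap_mono hB).trans measurable_fst.comap_le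
  have hgm : StronglyMeasurable[MeasurableSpace.comap Prod.fst B]
      (fun p : Θ × X => ∫ x, t x ∂(P p.1)) :=
    hg.comp_measurable (comap_measurable (m := B) (Prod.fst : Θ × X → Θ))
  have hi : Integrable (fun p : Θ × X => t p.2) (μ ⊗ₘ P) :=
    Integrable.of_bound (ht.comp measurable_snd).aestronglyMeasurable C
      (Filter.Eventually.of_forall fun p => hC p.2)
  have hb : ∀ θ, ‖∫ x, t x ∂(P θ)‖ ≤ C := fun θ => by
    simpa using norm_integral_le_of_norm_le_const (μ := P θ) (f := t)
      (Filter.Eventually.of_forall hC)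
  have hgi : Integrable (fun p : Θ × X => ∫ x, t x ∂(P p.1)) (μ ⊗ₘ P) :=
    Integrable.of_bound (hgm.mono hle).aestronglyMeasurable C
      (Filter.Eventually.of_forall fun p => hb p.1)
  refine ae_eq_condExp_of_forall_setIntegral_eq hle hi (fun s _ _ => hgi.integrableOn) ?_
    hgm.aestronglyMeasurable
  rintro s ⟨A, hA, rfl⟩ -
  have hA' := hB A hA
  rw [← Set.prod_univ, Measure.setIntegral_compProd hA' MeasurableSet.univ hgi.integrableOn,
    Measure.setIntegral_compProd hA' MeasurableSet.univ hi.integrableOn]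
  simp

/-- If `B` is a sampling-sufficient sub-σ-field of the parameter σ-field (every `θ ↦ P θ E`
is `B`-measurable), then in the Bayesian model `μ ⊗ₘ P` the conditional expectation of any
bounded function of the sample given the full parameter σ-field coincides a.s. with the one
given `B`: conditionally on the sufficient parameter the data carry no extra information. -/
theorem condexp_eq_of_sufficient
    {Θ X : Type*} [mΘ : MeasurableSpace Θ] [mX : MeasurableSpace X]
    (P : Kernel Θ X) [IsMarkovKernel P]
    (μ : Measure Θ) [IsProbabilityMeasure μ]
    (B : MeasurableSpace Θ) (hB : B ≤ mΘ)
    (hsuff : ∀ E : Set X, MeasurableSet E → Measurable[B] (fun θ => P θ E)) :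
    ∀ t : X → ℝ, Measurable t → (∃ C : ℝ, ∀ x, |t x| ≤ C) →
      (μ ⊗ₘ P)[fun p : Θ × X => t p.2 | MeasurableSpace.comap Prod.fst mΘ]
        =ᵐ[μ ⊗ₘ P]
      (μ ⊗ₘ P)[fun p : Θ × X => t p.2 | MeasurableSpace.comap Prod.fst B] := by
  intro t ht hC
  exact (aux_condexp mΘ (mΘ := mΘ) P μ le_rfl (fun E hE => P.measurable_coe hE) t ht hC).symm.trans
    (aux_condexp B (mΘ := mΘ) P μ hB hsuff t ht hC)
end

section
/- Let (Θ,𝒜,μ) be a complete probability space, Γ a locally compact Polish space, Φ a standard Borel space, A : Θ × Γ → Φ a jointly measurable map, and A₀ a Borel subset of Φ. For θ ∈ Θ define Γ_I(θ) := {γ ∈ Γ : A(θ,γ) ∈ A₀}. Assume that for μ-almost every θ the set Γ_I(θ) is a regular closed subset of Γ (i.e., Γ_I(θ) equals the closure of its interior). Then Γ_I is a closed random set: for every compact set K ⊆ Γ, the set {θ ∈ Θ : Γ_I(θ) ∩ K ≠ ∅} belongs to 𝒜. -/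
open MeasureTheory
open scoped ENNReal

/-- If `Γ_I(θ) = {γ : A(θ,γ) ∈ A₀}` has `μ`-a.s. regular closed realizations, with `A`
jointly measurable, `A₀` Borel, `(Θ,𝒜,μ)` a complete probability space and `Γ` a locally
compact Polish space, then `Γ_I` is a closed random set: the hitting events of compact sets
are measurable. -/
theorem identifiedSet_isClosedRandomSet
    {Θ Γ Φ : Type*} [mΘ : MeasurableSpace Θ]
    (μ : Measure Θ) [IsProbabilityMeasure μ] [μ.IsComplete]
    [TopologicalSpace Γ] [PolishSpace Γ] [LocallyCompactSpace Γ]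
    [MeasurableSpace Γ] [BorelSpace Γ]
    [MeasurableSpace Φ] [StandardBorelSpace Φ]
    (A : Θ × Γ → Φ) (hA : Measurable A)
    (A₀ : Set Φ) (hA₀ : MeasurableSet A₀)
    (hreg : ∀ᵐ θ ∂μ,
      closure (interior {γ : Γ | A (θ, γ) ∈ A₀}) = {γ : Γ | A (θ, γ) ∈ A₀}) :
    ∀ K : Set Γ, IsCompact K →
      MeasurableSet {θ : Θ | ({γ : Γ | A (θ, γ) ∈ A₀} ∩ K).Nonempty} := by
  intro K hK
  let _ := TopologicalSpace.upgradeIsCompletelyMetrizable Γ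
  obtain ⟨D, hDc, hDd⟩ := TopologicalSpace.exists_countable_dense Γ
  have hB : MeasurableSet (⋂ n : ℕ, ⋃ d ∈ D ∩ Metric.thickening (1 / ((n : ℝ) + 1)) K,
      {θ : Θ | A (θ, d) ∈ A₀}) := by
    refine MeasurableSet.iInter fun n => ?_
    refine MeasurableSet.biUnion (hDc.mono Set.inter_subset_left) fun d _ => ?_
    exact (hA.comp (measurable_id.prodMk measurable_const)) hA₀
  refine (NullMeasurableSet.congr (μ := μ) hB.nullMeasurableSet ?_).measurable_of_complete
  filter_upwards [hreg] with θ hθ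
  apply propext
  have hcl : IsClosed {γ : Γ | A (θ, γ) ∈ A₀} := hθ ▸ isClosed_closure
  change θ ∈ (⋂ n : ℕ, ⋃ d ∈ D ∩ Metric.thickening (1 / ((n : ℝ) + 1)) K,
      {θ : Θ | A (θ, d) ∈ A₀}) ↔ ({γ : Γ | A (θ, γ) ∈ A₀} ∩ K).Nonempty
  simp only [Set.mem_iInter, Set.mem_iUnion, Set.mem_setOf_eq, exists_prop]
  constructor
  · intro h
    by_contra hne
    have hsub : K ⊆ {γ : Γ | A (θ, γ) ∈ A₀}ᶜ := fun k hk hk' => hne ⟨k, hk', hk⟩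
    obtain ⟨δ, hδ, hδs⟩ := hK.exists_thickening_subset_open hcl.isOpen_compl hsub
    obtain ⟨n, hn⟩ := exists_nat_one_div_lt hδ
    obtain ⟨d, ⟨-, hd⟩, hdA⟩ := h n
    exact hδs (Metric.thickening_mono hn.le K hd) hdA
  · rintro ⟨k, hkA, hkK⟩ n
    have hpos : (0 : ℝ) < 1 / ((n : ℝ) + 1) := by positivity
    have hkT := Metric.self_subset_thickening hpos K hkK
    have hkc : k ∈ closure (interior {γ : Γ | A (θ, γ) ∈ A₀}) := by rw [hθ]; exact hkA
    have hne := mem_closure_iff.1 hkc _ Metric.isOpen_thickening hkT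
    obtain ⟨d, hd, hdD⟩ := hDd.inter_open_nonempty _
      (Metric.isOpen_thickening.inter isOpen_interior) hne
    have hdA : d ∈ {γ : Γ | A (θ, γ) ∈ A₀} := interior_subset hd.2
    exact ⟨d, ⟨hdD, hd.1⟩, hdA⟩
end

section
/- Let (Ω,ℱ,Π) be a probability space, (𝒢ₙ)ₙ an increasing sequence of sub-σ-fields of ℱ with 𝒢_∞ := ⋁ₙ 𝒢ₙ, and let ℬ ⊆ ℱ be a sub-σ-field. Let c : Ω → ℝ be integrable. Assume: (a) ℬ is asymptotically exactly estimable, i.e., every bounded ℬ-measurable function is Π-a.s. equal to a 𝒢_∞-measurable function; and (b) E_Π[c | 𝒢_∞ ∨ ℬ] = E_Π[c | ℬ] Π-a.s. (conditional independence of c and the full data given ℬ). Then E_Π[c | 𝒢ₙ] → E_Π[c | ℬ] Π-almost surely as n → ∞. -/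
open MeasureTheory ProbabilityTheory Filter
open scoped ENNReal Topology

/-- If the identified σ-field `B` is asymptotically exactly estimable from the increasing
data σ-fields `𝒢 n` and the data carry no information about `c` beyond `B`, then the
posterior means `E[c | 𝒢 n]` converge a.s. to the conditional prior mean `E[c | B]`. -/
theorem condexp_tendsto_condexp_identified
    {Ω : Type*} [F : MeasurableSpace Ω] (Pr : Measure Ω) [IsProbabilityMeasure Pr]
    (𝒢 : ℕ → MeasurableSpace Ω) (hmono : Monotone 𝒢) (hle : ∀ n, 𝒢 n ≤ F)
    (B : MeasurableSpace Ω) (hB : B ≤ F)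
    (c : Ω → ℝ) (hc : Integrable c Pr)
    (hest : ∀ f : Ω → ℝ, Measurable[B] f → (∃ C : ℝ, ∀ ω, |f ω| ≤ C) →
      ∃ g : Ω → ℝ, Measurable[⨆ n, 𝒢 n] g ∧ f =ᵐ[Pr] g)
    (hci : Pr[c | (⨆ n, 𝒢 n) ⊔ B] =ᵐ[Pr] Pr[c | B]) :
    ∀ᵐ ω ∂Pr, Tendsto (fun n => (Pr[c | 𝒢 n]) ω) atTop (𝓝 ((Pr[c | B]) ω)) := by
  have hG : (⨆ n, 𝒢 n) ≤ F := iSup_le hle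
  have htan : Measurable Real.tan := by
    have h : Real.tan = fun x => Real.sin x / Real.cos x := by
      funext x
      exact Real.tan_eq_sin_div_cos x
    rw [h]
    exact Real.measurable_sin.div Real.measurable_cos
  have hae : AEStronglyMeasurable[⨆ n, 𝒢 n] (Pr[c | B]) Pr := by
    obtain ⟨g, hg, hfg⟩ := hest (fun ω => Real.arctan ((Pr[c | B]) ω))
      (Real.measurable_arctan.comp stronglyMeasurable_condExp.measurable)
      ⟨Real.pi / 2, fun ω => abs_le.2
        ⟨by linarith [Real.neg_pi_div_two_lt_arctan ((Pr[c | B]) ω)],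
          (Real.arctan_lt_pi_div_two _).le⟩⟩
    refine ⟨fun ω => Real.tan (g ω), (htan.comp hg).stronglyMeasurable, ?_⟩
    filter_upwards [hfg] with ω hω
    rw [← hω, Real.tan_arctan]
  have h1 : Pr[c | ⨆ n, 𝒢 n] =ᵐ[Pr] Pr[c | B] :=
    ((condExp_condExp_of_le (f := c) (μ := Pr) (le_sup_left : (⨆ n, 𝒢 n) ≤ (⨆ n, 𝒢 n) ⊔ B)
      (sup_le hG hB)).symm.trans (condExp_congr_ae hci)).trans
      (condExp_of_aestronglyMeasurable' hG hae integrable_condExp)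
  let ℱ : Filtration ℕ F := ⟨𝒢, hmono, hle⟩
  have h2 := tendsto_ae_condExp (μ := Pr) (ℱ := ℱ) c
  filter_upwards [h1, h2] with ω hω h2ω
  rw [← hω]
  exact h2ω
end
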